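/- arXiv:2512.09376 — 4 statements merged into one kernel-verified Lean document; each statement's English description precedes it below -/
import Mathlib

section
/- Let X be a compact metric space, let ν and ν₀ be Borel probability measures on X, and let λ > 0. Let f : X → ℝ^m be Lipschitz with constant K_f, let u : X → ℝ be Lipschitz with constant K_u and satisfy ‖u‖_∞ ≤ 1, and let w ∈ ℝ with |w| ≤ 1. Set c_λ = ∫_X exp(−λ‖f(x)‖²) dν(x) and assume c_λ > 0. Suppose W ≥ 0 satisfies the Kantorovich bound: for every L ≥ 0 and every L-Lipschitz function g : X → ℝ, |∫_X g dν − ∫_X g dν₀| ≤ L·W. If moreover W ≤ c_λ / (2(√λ·K_f + K_u)), then |w·(∫_X e^{−λ‖f‖²} u dν)/(∫_X e^{−λ‖f‖²} dν) − w·(∫_X e^{−λ‖f‖²} u dν₀)/(∫_X e^{−λ‖f‖²} dν₀)| ≤ ((2√λ·K_f + K_u)/(c_λ²/2))·W. -/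
open MeasureTheory
open scoped NNReal

theorem lipschitzWith_exp_neg_sq : LipschitzWith 1 (fun t : ℝ => Real.exp (-t ^ 2)) := by
  have hd : ∀ t : ℝ, HasDerivAt (fun t : ℝ => Real.exp (-t ^ 2))
      (Real.exp (-t ^ 2) * (-(2 * t))) t := by
    intro t
    have h : HasDerivAt (fun t : ℝ => -t ^ 2) (-(2 * t)) t := by
      simpa using (hasDerivAt_pow 2 t).fun_neg
    exact h.exp
  refine lipschitzWith_of_nnnorm_deriv_le (fun t => (hd t).differentiableAt) fun t => ?_
  rw [(hd t).deriv, ← NNReal.coe_le_coe, coe_nnnorm, Real.norm_eq_abs, abs_mul, abs_neg,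
    Real.abs_exp, Real.exp_neg, NNReal.coe_one, inv_mul_le_one₀ (Real.exp_pos _)]
  have h := Real.add_one_le_exp (t ^ 2)
  exact abs_le.2 ⟨by nlinarith [sq_nonneg (t + 1)], by nlinarith [sq_nonneg (t - 1)]⟩

theorem LipschitzWith.exp_neg_mul_norm_sq {X E : Type*} [PseudoMetricSpace X]
    [SeminormedAddCommGroup E] {f : X → E} {K : ℝ≥0} (hf : LipschitzWith K f)
    {lam : ℝ} (hlam : 0 ≤ lam) :
    LipschitzWith (Real.toNNReal (Real.sqrt lam) * K)
      (fun x => Real.exp (-lam * ‖f x‖ ^ 2)) := by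
  refine LipschitzWith.of_dist_le_mul fun x y => ?_
  have h := lipschitzWith_exp_neg_sq.dist_le_mul (Real.sqrt lam * ‖f x‖) (Real.sqrt lam * ‖f y‖)
  simp only [mul_pow, Real.sq_sqrt hlam, ← neg_mul, NNReal.coe_one, one_mul] at h
  refine h.trans ?_
  rw [Real.dist_eq, ← mul_sub, abs_mul, abs_of_nonneg (Real.sqrt_nonneg _), NNReal.coe_mul,
    Real.coe_toNNReal _ (Real.sqrt_nonneg _), mul_assoc]
  gcongr
  exact (abs_norm_sub_norm_le _ _).trans (by simpa [dist_eq_norm] using hf.dist_le_mul x y)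

theorem LipschitzWith.mul_of_abs_le_one {X : Type*} [PseudoMetricSpace X] {g u : X → ℝ}
    {A B : ℝ≥0} (hg : LipschitzWith A g) (hu : LipschitzWith B u)
    (hg1 : ∀ x, |g x| ≤ 1) (hu1 : ∀ x, |u x| ≤ 1) :
    LipschitzWith (A + B) (fun x => g x * u x) := by
  refine LipschitzWith.of_dist_le_mul fun x y => ?_
  have h1 := hg.dist_le_mul x y
  have h2 := hu.dist_le_mul x y
  rw [Real.dist_eq] at h1 h2 ⊢
  calc |g x * u x - g y * u y| = |g x * (u x - u y) + (g x - g y) * u y| := by ring_nf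
    _ ≤ |g x| * |u x - u y| + |g x - g y| * |u y| := by
      simpa only [abs_mul] using abs_add_le (g x * (u x - u y)) ((g x - g y) * u y)
    _ ≤ 1 * |u x - u y| + |g x - g y| * 1 := by
      gcongr
      exacts [hg1 x, hu1 y]
    _ ≤ ((A + B : ℝ≥0) : ℝ) * dist x y := by push_cast; linarith

/-- Stability of a quotient `N / c` bounded by one in absolute value at the second point. -/
theorem abs_div_sub_div_le {N N₀ c c₀ a b : ℝ} (hc : 0 < c) (hc₀ : 0 < c₀) (hN₀ : |N₀| ≤ c₀)
    (hN : |N - N₀| ≤ a) (hcc : |c - c₀| ≤ b) :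
    |N / c - N₀ / c₀| ≤ (a + b) / c := by
  have hq : |N₀ / c₀| ≤ 1 := by
    rw [abs_div, abs_of_pos hc₀]
    exact (div_le_one hc₀).2 hN₀
  have key : N / c - N₀ / c₀ = ((N - N₀) - N₀ / c₀ * (c - c₀)) / c := by
    field_simp
    ring
  rw [key, abs_div, abs_of_pos hc]
  gcongr
  refine (abs_sub _ _).trans (add_le_add hN ?_)
  rw [abs_mul]
  calc |N₀ / c₀| * |c - c₀| ≤ 1 * |c - c₀| := by gcongr
    _ ≤ b := by rwa [one_mul]

/-- Discretization stability of the levelset integral kernel: if `ν, ν₀` are Borel probability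
measures on a compact metric space satisfying the Kantorovich bound with constant `W`
(the role of `W₁(ν,ν₀)`), `f` is `K_f`-Lipschitz, `u` is `K_u`-Lipschitz with `‖u‖_∞ ≤ 1`,
`|w| ≤ 1`, `c_λ = ∫ exp(−λ‖f‖²) dν > 0`, and `W ≤ c_λ/(2(√λ K_f + K_u))`, then the levelset
integral kernels with base measures `ν` and `ν₀` differ by at most
`((2√λ K_f + K_u)/(c_λ²/2))·W`. -/
theorem levelset_kernel_discretization {X : Type*} [MetricSpace X] [CompactSpace X]
    [MeasurableSpace X] [BorelSpace X]
    (ν ν₀ : Measure X) [IsProbabilityMeasure ν] [IsProbabilityMeasure ν₀]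
    (lam : ℝ) (hlam : 0 < lam) {m : ℕ}
    (f : X → EuclideanSpace ℝ (Fin m)) (Kf : ℝ≥0) (hf : LipschitzWith Kf f)
    (u : X → ℝ) (Ku : ℝ≥0) (hu : LipschitzWith Ku u) (hub : ∀ x, |u x| ≤ 1)
    (w : ℝ) (hw : |w| ≤ 1)
    (c : ℝ) (hc : c = ∫ x, Real.exp (-lam * ‖f x‖ ^ 2) ∂ν) (hcpos : 0 < c)
    (W : ℝ) (hW : 0 ≤ W)
    (hKant : ∀ (L : ℝ≥0) (g : X → ℝ), LipschitzWith L g →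
      |(∫ x, g x ∂ν) - ∫ x, g x ∂ν₀| ≤ (L : ℝ) * W)
    (hWsmall : W ≤ c / (2 * (Real.sqrt lam * Kf + Ku))) :
    |w * (∫ x, Real.exp (-lam * ‖f x‖ ^ 2) * u x ∂ν)
        / (∫ x, Real.exp (-lam * ‖f x‖ ^ 2) ∂ν)
      - w * (∫ x, Real.exp (-lam * ‖f x‖ ^ 2) * u x ∂ν₀)
        / (∫ x, Real.exp (-lam * ‖f x‖ ^ 2) ∂ν₀)|
      ≤ ((2 * Real.sqrt lam * Kf + Ku) / (c ^ 2 / 2)) * W := by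
  have hg := hf.exp_neg_mul_norm_sq hlam.le
  have hg1 : ∀ x, Real.exp (-lam * ‖f x‖ ^ 2) ≤ 1 := fun x =>
    Real.exp_le_one_iff.2 (by nlinarith [mul_nonneg hlam.le (sq_nonneg ‖f x‖)])
  have hgu := hg.mul_of_abs_le_one hu (fun x => by rw [Real.abs_exp]; exact hg1 x) hub
  have hint : ∀ (μ : Measure X) [IsProbabilityMeasure μ],
      Integrable (fun x => Real.exp (-lam * ‖f x‖ ^ 2)) μ := fun μ _ =>
    hg.continuous.integrable_of_hasCompactSupport (HasCompactSupport.of_compactSpace _)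
  have hc₀ : 0 < ∫ x, Real.exp (-lam * ‖f x‖ ^ 2) ∂ν₀ := integral_exp_pos (hint ν₀)
  have hN₀ : |∫ x, Real.exp (-lam * ‖f x‖ ^ 2) * u x ∂ν₀|
      ≤ ∫ x, Real.exp (-lam * ‖f x‖ ^ 2) ∂ν₀ := by
    rw [← Real.norm_eq_abs]
    refine norm_integral_le_of_norm_le (hint ν₀) (Filter.Eventually.of_forall fun x => ?_)
    rw [Real.norm_eq_abs, abs_mul, Real.abs_exp]
    exact mul_le_of_le_one_right (Real.exp_pos _).le (hub x)
  have hc1 : c ≤ 1 := by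
    rw [hc]
    simpa using integral_mono (hint ν) (integrable_const (1 : ℝ)) hg1
  have h := abs_div_sub_div_le (hc ▸ hcpos) hc₀ hN₀ (hKant _ _ hgu) (hKant _ _ hg)
  rw [← hc] at h ⊢
  rw [mul_div_assoc, mul_div_assoc, ← mul_sub, abs_mul]
  refine (mul_le_of_le_one_left (abs_nonneg _) hw).trans (h.trans ?_)
  push_cast
  rw [Real.coe_toNNReal _ (Real.sqrt_nonneg _), div_mul_eq_mul_div]
  have hnum : (Real.sqrt lam * Kf + Ku) * W + Real.sqrt lam * Kf * W
      = (2 * Real.sqrt lam * Kf + Ku) * W := by ring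
  rw [hnum]
  gcongr
  nlinarith
end

section
/- Let X be a compact metric space and let ν be a nonzero finite Borel measure on X with full support (ν(U) > 0 for every nonempty open U ⊆ X). Let f : X → ℝ^m and u : X → ℝ be continuous, and suppose f has a unique zero x₀ ∈ X, i.e., f(x) = 0 if and only if x = x₀. Then lim_{λ → ∞} (∫_X exp(−λ‖f(x)‖²) u(x) dν(x)) / (∫_X exp(−λ‖f(x)‖²) dν(x)) = u(x₀), where ‖·‖ is the Euclidean norm on ℝ^m. -/
open MeasureTheory Filter

section Laplace

variable {X : Type*} [TopologicalSpace X] [CompactSpace X] [MeasurableSpace X] [BorelSpace X]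
  {ν : Measure X} [IsFiniteMeasure ν] {g : X → ℝ}

theorem integrable_of_continuous_of_compactSpace (hg : Continuous g) : Integrable g ν :=
  hg.integrable_of_hasCompactSupport (HasCompactSupport.of_compactSpace g)

/-- Lower bound for a Laplace integral by the mass of a sublevel set of the phase. -/
theorem exp_mul_measureReal_le_integral_exp (hg : Continuous g) (c : ℝ) {r : ℝ} (hr : 0 ≤ r) :
    Real.exp (-r * c) * ν.real {x | g x < c} ≤ ∫ x, Real.exp (-r * g x) ∂ν := by
  have hint : Integrable (fun x => Real.exp (-r * g x)) ν :=
    integrable_of_continuous_of_compactSpace (by fun_prop)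
  have hmeas : MeasurableSet {x | g x < c} := (isOpen_lt hg continuous_const).measurableSet
  calc Real.exp (-r * c) * ν.real {x | g x < c}
      = ∫ _ in {x | g x < c}, Real.exp (-r * c) ∂ν := by simp [mul_comm]
    _ ≤ ∫ x in {x | g x < c}, Real.exp (-r * g x) ∂ν := by
        refine setIntegral_mono_on (integrable_const _) hint.integrableOn hmeas fun x hx => ?_
        have hx' : g x ≤ c := le_of_lt hx
        exact Real.exp_le_exp.2 (by nlinarith)
    _ ≤ ∫ x, Real.exp (-r * g x) ∂ν :=
        setIntegral_le_integral hint (Eventually.of_forall fun _ => (Real.exp_pos _).le)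

/-- The normalized weights `exp (-r g) / ∫ exp (-r g)` converge to zero uniformly away from the
unique minimum of `g`. -/
theorem tendstoUniformlyOn_exp_div_integral_exp {x₀ : X} (hg : Continuous g)
    (hν : ∀ U : Set X, IsOpen U → x₀ ∈ U → 0 < ν U) (hmin : ∀ x, x ≠ x₀ → g x₀ < g x)
    {U : Set X} (hU : IsOpen U) (hxU : x₀ ∈ U) :
    TendstoUniformlyOn (fun (r : ℝ) x => Real.exp (-r * g x) / ∫ y, Real.exp (-r * g y) ∂ν)
      0 atTop Uᶜ := by
  obtain ⟨c, hc, hcU⟩ : ∃ c, g x₀ < c ∧ ∀ x ∈ Uᶜ, c ≤ g x := by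
    rcases Uᶜ.eq_empty_or_nonempty with h | h
    · exact ⟨g x₀ + 1, by linarith, by simp [h]⟩
    · obtain ⟨x, hx, hxmin⟩ := hU.isClosed_compl.isCompact.exists_isMinOn h hg.continuousOn
      exact ⟨g x, hmin x fun h => hx (h ▸ hxU), fun y hy => hxmin hy⟩
  obtain ⟨b, hb, hbc⟩ := exists_between hc
  have hmass : 0 < ν.real {x | g x < b} :=
    ENNReal.toReal_pos (hν _ (isOpen_lt hg continuous_const) hb).ne' (measure_ne_top _ _)
  have hlim : Tendsto (fun r : ℝ => Real.exp (-(r * (c - b))) / ν.real {x | g x < b})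
      atTop (nhds 0) := by
    simpa using (Real.tendsto_exp_neg_atTop_nhds_zero.comp
      (tendsto_id.atTop_mul_const (sub_pos.2 hbc))).div_const (ν.real {x | g x < b})
  refine Metric.tendstoUniformlyOn_iff.2 fun ε hε => ?_
  filter_upwards [(tendsto_order.1 hlim).2 ε hε, eventually_ge_atTop 0] with r hrε hr x hx
  have hbound := exp_mul_measureReal_le_integral_exp (ν := ν) hg b hr
  have hnonneg : 0 ≤ Real.exp (-r * g x) / ∫ y, Real.exp (-r * g y) ∂ν :=
    div_nonneg (Real.exp_pos _).le (integral_nonneg fun _ => (Real.exp_pos _).le)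
  rw [Pi.zero_apply, dist_zero_left, Real.norm_of_nonneg hnonneg]
  refine lt_of_le_of_lt ?_ hrε
  calc Real.exp (-r * g x) / ∫ y, Real.exp (-r * g y) ∂ν
      ≤ Real.exp (-r * c) / (Real.exp (-r * b) * ν.real {x | g x < b}) := by
        refine div_le_div₀ (Real.exp_pos _).le (Real.exp_le_exp.2 ?_) (by positivity) hbound
        nlinarith [hcU x hx]
    _ = Real.exp (-(r * (c - b))) / ν.real {x | g x < b} := by
        rw [← div_div, ← Real.exp_sub]
        ring_nf

/-- **Laplace concentration**: Gibbs averages of a continuous function converge to its value at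
the unique minimum of the phase. -/
theorem tendsto_integral_exp_mul_div_integral_exp {u : X → ℝ} {x₀ : X} (hg : Continuous g)
    (hu : Continuous u) (hν : ∀ U : Set X, IsOpen U → x₀ ∈ U → 0 < ν U)
    (hmin : ∀ x, x ≠ x₀ → g x₀ < g x) :
    Tendsto (fun r : ℝ =>
        (∫ x, Real.exp (-r * g x) * u x ∂ν) / (∫ x, Real.exp (-r * g x) ∂ν))
      atTop (nhds (u x₀)) := by
  have hν₀ : NeZero ν := ⟨by
    rintro rfl
    simpa using hν Set.univ isOpen_univ (Set.mem_univ x₀)⟩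
  have hpos (r : ℝ) : 0 < ∫ x, Real.exp (-r * g x) ∂ν :=
    integral_exp_pos (integrable_of_continuous_of_compactSpace (by fun_prop))
  have hpeak := tendsto_integral_peak_smul_of_integrable_of_tendsto (μ := ν) (x₀ := x₀)
    (φ := fun (r : ℝ) x => Real.exp (-r * g x) / ∫ y, Real.exp (-r * g y) ∂ν) (l := atTop)
    MeasurableSet.univ univ_mem (measure_ne_top _ _)
    (Eventually.of_forall fun r x => div_nonneg (Real.exp_pos _).le (hpos r).le)
    (fun U hU hxU => tendstoUniformlyOn_exp_div_integral_exp hg hν hmin hU hxU)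
    (by simp only [setIntegral_univ, integral_div, div_self (hpos _).ne', tendsto_const_nhds])
    (Eventually.of_forall fun r => Continuous.aestronglyMeasurable (by fun_prop))
    (integrable_of_continuous_of_compactSpace hu) (hu.tendsto x₀)
  refine hpeak.congr fun r => ?_
  simp only [smul_eq_mul, div_mul_eq_mul_div, integral_div]

end Laplace

/-- Laplace-type concentration for the levelset integral kernel: if `ν` is a nonzero finite
Borel measure of full support on a compact metric space `X`, `f : X → ℝ^m` and `u : X → ℝ`
are continuous, and `f` has a unique zero `x₀`, then
`(∫ exp(−λ‖f‖²) u dν)/(∫ exp(−λ‖f‖²) dν) → u(x₀)` as `λ → ∞`. -/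
theorem levelset_kernel_concentration {X : Type*} [MetricSpace X] [CompactSpace X]
    [MeasurableSpace X] [BorelSpace X]
    (ν : Measure X) [IsFiniteMeasure ν] (hν : ν ≠ 0)
    (hsupp : ∀ U : Set X, IsOpen U → U.Nonempty → 0 < ν U) {m : ℕ}
    (f : X → EuclideanSpace ℝ (Fin m)) (u : X → ℝ) (hf : Continuous f) (hu : Continuous u)
    (x₀ : X) (hzero : ∀ x, f x = 0 ↔ x = x₀) :
    Tendsto (fun lam : ℝ =>
        (∫ x, Real.exp (-lam * ‖f x‖ ^ 2) * u x ∂ν) / (∫ x, Real.exp (-lam * ‖f x‖ ^ 2) ∂ν))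
      atTop (nhds (u x₀)) := by
  refine tendsto_integral_exp_mul_div_integral_exp (g := fun x => ‖f x‖ ^ 2) (by fun_prop) hu
    (fun U hU hxU => hsupp U hU ⟨x₀, hxU⟩) fun x hx => ?_
  have hfx : f x ≠ 0 := mt (hzero x).1 hx
  have hfx₀ : f x₀ = 0 := (hzero x₀).2 rfl
  have hnorm : 0 < ‖f x‖ ^ 2 := by positivity
  simpa [hfx₀] using hnorm
end

section
/- Let X be a compact metric space with a finite Borel measure ν, let λ > 0 and ε ≥ 0, and let f, f̂ : X → ℝ^m be measurable with sup_{x ∈ X} ‖f(x) − f̂(x)‖ ≤ ε. Set c = ∫_X exp(−λ‖f‖²) dν and ĉ = ∫_X exp(−λ‖f̂‖²) dν, and assume c > 0 and ĉ > 0. Let w > 0 and define ŵ = w·ĉ/c. Then for every bounded measurable u : X → ℝ, |w·(∫_X e^{−λ‖f‖²} u dν)/c − ŵ·(∫_X e^{−λ‖f̂‖²} u dν)/ĉ| ≤ (w/c)·√λ·ε·‖u‖_∞·ν(X). -/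
open MeasureTheory

/-- The Gaussian `t ↦ exp (-t²)` is `1`-Lipschitz. -/
theorem abs_exp_neg_sq_sub_le (a b : ℝ) :
    |Real.exp (-a ^ 2) - Real.exp (-b ^ 2)| ≤ |a - b| := by
  have hderiv (t : ℝ) :
      HasDerivAt (fun s : ℝ => Real.exp (-s ^ 2)) (Real.exp (-t ^ 2) * -(2 * t)) t := by
    simpa using ((hasDerivAt_pow 2 t).neg).exp
  have hbound (t : ℝ) : ‖Real.exp (-t ^ 2) * -(2 * t)‖ ≤ 1 := by
    rw [norm_mul, norm_neg, Real.norm_eq_abs, Real.norm_eq_abs, Real.abs_exp, Real.exp_neg,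
      inv_mul_le_one₀ (Real.exp_pos _), abs_mul, abs_two]
    nlinarith [Real.add_one_le_exp (t ^ 2), sq_nonneg (|t| - 1), sq_abs t]
  simpa using convex_univ.norm_image_sub_le_of_norm_hasDerivWithin_le
    (fun t _ => (hderiv t).hasDerivWithinAt) (fun t _ => hbound t) (Set.mem_univ b)
    (Set.mem_univ a)

/-- The Gaussian levelset weight at scale `lam` is `√lam`-Lipschitz in the value of the map. -/
theorem abs_exp_neg_mul_norm_sq_sub_le {E : Type*} [SeminormedAddCommGroup E] {lam : ℝ}
    (hlam : 0 ≤ lam) (x y : E) :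
    |Real.exp (-lam * ‖x‖ ^ 2) - Real.exp (-lam * ‖y‖ ^ 2)| ≤ Real.sqrt lam * ‖x - y‖ := by
  have hscale (z : E) : -lam * ‖z‖ ^ 2 = -(Real.sqrt lam * ‖z‖) ^ 2 := by
    rw [mul_pow, Real.sq_sqrt hlam, neg_mul]
  rw [hscale, hscale]
  refine (abs_exp_neg_sq_sub_le _ _).trans ?_
  rw [← mul_sub, abs_mul, abs_of_nonneg (Real.sqrt_nonneg lam)]
  gcongr
  exact abs_norm_sub_norm_le x y

/-- A bounded measurable function times a Gaussian levelset weight is integrable. -/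
theorem integrable_exp_neg_mul_norm_sq_mul {X E : Type*} [MeasurableSpace X]
    [SeminormedAddCommGroup E] [MeasurableSpace E] [OpensMeasurableSpace E] {ν : Measure X}
    [IsFiniteMeasure ν] {lam M : ℝ} (hlam : 0 ≤ lam) {f : X → E} (hf : Measurable f)
    {u : X → ℝ} (hu : Measurable u) (hub : ∀ x, |u x| ≤ M) :
    Integrable (fun x => Real.exp (-lam * ‖f x‖ ^ 2) * u x) ν := by
  refine Integrable.of_bound (Measurable.aestronglyMeasurable (by fun_prop)) M
    (Filter.Eventually.of_forall fun x => ?_)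
  rw [norm_mul, Real.norm_eq_abs, Real.abs_exp]
  refine (mul_le_of_le_one_left (norm_nonneg _) (Real.exp_le_one_iff.2 ?_)).trans (hub x)
  nlinarith [mul_nonneg hlam (sq_nonneg ‖f x‖)]

/-- Perturbation of the levelset integral kernel with matched normalization: with
`‖f − f̂‖_∞ ≤ ε`, `c = ∫ exp(−λ‖f‖²) dν > 0`, `ĉ = ∫ exp(−λ‖f̂‖²) dν > 0`, `w > 0`, and
`ŵ = w·ĉ/c`, the two normalized kernels applied to a measurable `u` bounded by `M` differ by
at most `(w/c)·√λ·ε·M·ν(X)`. -/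
theorem levelset_kernel_perturbation {X : Type*} [MetricSpace X] [CompactSpace X]
    [MeasurableSpace X] [BorelSpace X]
    (ν : Measure X) [IsFiniteMeasure ν]
    (lam ε : ℝ) (hlam : 0 < lam) (hε : 0 ≤ ε) {m : ℕ}
    (f fh : X → EuclideanSpace ℝ (Fin m)) (hfm : Measurable f) (hfhm : Measurable fh)
    (hclose : ∀ x, ‖f x - fh x‖ ≤ ε)
    (c ch : ℝ) (hc : c = ∫ x, Real.exp (-lam * ‖f x‖ ^ 2) ∂ν)
    (hch : ch = ∫ x, Real.exp (-lam * ‖fh x‖ ^ 2) ∂ν)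
    (hcpos : 0 < c) (hchpos : 0 < ch)
    (w : ℝ) (hw : 0 < w) (wh : ℝ) (hwh : wh = w * ch / c)
    (u : X → ℝ) (hum : Measurable u) (M : ℝ) (hub : ∀ x, |u x| ≤ M) :
    |w * (∫ x, Real.exp (-lam * ‖f x‖ ^ 2) * u x ∂ν) / c
      - wh * (∫ x, Real.exp (-lam * ‖fh x‖ ^ 2) * u x ∂ν) / ch|
      ≤ (w / c) * Real.sqrt lam * ε * M * (ν Set.univ).toReal := by
  have hfactor : w * (∫ x, Real.exp (-lam * ‖f x‖ ^ 2) * u x ∂ν) / c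
      - wh * (∫ x, Real.exp (-lam * ‖fh x‖ ^ 2) * u x ∂ν) / ch
      = w / c * ∫ x, (Real.exp (-lam * ‖f x‖ ^ 2) * u x
        - Real.exp (-lam * ‖fh x‖ ^ 2) * u x) ∂ν := by
    rw [integral_sub (integrable_exp_neg_mul_norm_sq_mul hlam.le hfm hum hub)
      (integrable_exp_neg_mul_norm_sq_mul hlam.le hfhm hum hub), hwh]
    field_simp
  have hpointwise (x : X) : ‖Real.exp (-lam * ‖f x‖ ^ 2) * u x
      - Real.exp (-lam * ‖fh x‖ ^ 2) * u x‖ ≤ Real.sqrt lam * ε * M := by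
    rw [← sub_mul, norm_mul]
    refine mul_le_mul ((abs_exp_neg_mul_norm_sq_sub_le hlam.le _ _).trans ?_) (hub x)
      (norm_nonneg _) (by positivity)
    gcongr
    exact hclose x
  have hintegral := norm_integral_le_of_norm_le_const
    (μ := ν) (Filter.Eventually.of_forall hpointwise)
  rw [hfactor, abs_mul, abs_of_pos (div_pos hw hcpos)]
  calc _ ≤ w / c * (Real.sqrt lam * ε * M * (ν Set.univ).toReal) := by
        gcongr
        exact hintegral
    _ = _ := by ring
end

section
/- Let n ≥ 1, let A be an invertible real n × n matrix, let x₀ ∈ ℝⁿ, let u : ℝⁿ → ℝ be Lipschitz with constant K, and let λ > 0. Then |(λ/π)^{n/2} ∫_{ℝⁿ} exp(−λ‖A(x − x₀)‖²) u(x) dx − u(x₀)/|det A|| ≤ (K·‖A^{−1}‖_{op}·c_n / |det A|)·λ^{−1/2}, where ‖A^{−1}‖_{op} is the operator norm of A^{−1}, ‖·‖ is the Euclidean norm, and c_n = π^{−n/2} ∫_{ℝⁿ} exp(−‖z‖²)‖z‖ dz. -/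
open MeasureTheory Matrix
open scoped NNReal

section LinearChangeOfVariables

variable {E : Type*} [NormedAddCommGroup E] [NormedSpace ℝ E] [MeasurableSpace E] [BorelSpace E]
  [FiniteDimensional ℝ E] (μ : Measure E) [μ.IsAddHaarMeasure]

theorem integral_comp_linearMap {F : Type*} [NormedAddCommGroup F] [NormedSpace ℝ F]
    {f : E →ₗ[ℝ] E} (hf : LinearMap.det f ≠ 0) (g : E → F) :
    ∫ x, g (f x) ∂μ = |LinearMap.det f|⁻¹ • ∫ x, g x ∂μ := by
  let e := (f.equivOfDetNeZero hf).toContinuousLinearEquiv.toHomeomorph.toMeasurableEquiv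
  have h := integral_map_equiv (μ := μ) e g
  have he : Measure.map e μ = ENNReal.ofReal |(LinearMap.det f)⁻¹| • μ :=
    Measure.map_linearMap_addHaar_eq_smul_addHaar μ hf
  rw [he, integral_smul_measure, ENNReal.toReal_ofReal (abs_nonneg _), abs_inv] at h
  exact h.symm

theorem MeasureTheory.Integrable.comp_linearMap {F : Type*} [NormedAddCommGroup F]
    {f : E →ₗ[ℝ] E} (hf : LinearMap.det f ≠ 0) {g : E → F} (hg : Integrable g μ) :
    Integrable (fun x ↦ g (f x)) μ := by
  let e := (f.equivOfDetNeZero hf).toContinuousLinearEquiv.toHomeomorph.toMeasurableEquiv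
  have he : Measure.map e μ = ENNReal.ofReal |(LinearMap.det f)⁻¹| • μ :=
    Measure.map_linearMap_addHaar_eq_smul_addHaar μ hf
  refine (integrable_map_equiv (μ := μ) e g).mp ?_
  rw [he]
  exact hg.smul_measure ENNReal.ofReal_ne_top

theorem integrable_exp_neg_mul_sq_norm_mul_norm_pow [Nontrivial E] {b : ℝ} (hb : 0 < b) (k : ℕ) :
    Integrable (fun x : E ↦ Real.exp (-b * ‖x‖ ^ 2) * ‖x‖ ^ k) μ := by
  rw [integrable_fun_norm_addHaar μ (f := fun r : ℝ ↦ Real.exp (-b * r ^ 2) * r ^ k)]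
  have h := integrableOn_rpow_mul_exp_neg_mul_sq hb
    (s := ((Module.finrank ℝ E - 1 + k : ℕ) : ℝ)) (neg_one_lt_zero.trans_le (Nat.cast_nonneg _))
  refine h.congr_fun (fun y _ ↦ ?_) measurableSet_Ioi
  simp only [Real.rpow_natCast, smul_eq_mul]
  ring

theorem integral_exp_neg_mul_sq_norm_mul_norm {b : ℝ} (hb : 0 < b) :
    ∫ x, Real.exp (-b * ‖x‖ ^ 2) * ‖x‖ ∂μ =
      b ^ (-(Module.finrank ℝ E : ℝ) / 2) * b ^ (-(1 : ℝ) / 2) *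
        ∫ x, Real.exp (-‖x‖ ^ 2) * ‖x‖ ∂μ := by
  have hs : 0 < √b := Real.sqrt_pos.mpr hb
  have h := Measure.integral_comp_smul μ (fun x : E ↦ Real.exp (-‖x‖ ^ 2) * ‖x‖) √b
  have hfun (x : E) : Real.exp (-‖√b • x‖ ^ 2) * ‖√b • x‖ =
      √b * (Real.exp (-b * ‖x‖ ^ 2) * ‖x‖) := by
    rw [norm_smul, Real.norm_of_nonneg hs.le, mul_pow, Real.sq_sqrt hb.le]
    ring_nf
  have hpow : b ^ (-(Module.finrank ℝ E : ℝ) / 2) = (√b ^ Module.finrank ℝ E)⁻¹ := by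
    rw [Real.sqrt_eq_rpow, ← Real.rpow_mul_natCast hb.le, ← Real.rpow_neg hb.le]
    ring_nf
  have hhalf : b ^ (-(1 : ℝ) / 2) = (√b)⁻¹ := by
    rw [Real.sqrt_eq_rpow, ← Real.rpow_neg hb.le]
    ring_nf
  simp_rw [hfun] at h
  rw [integral_const_mul, abs_of_pos (by positivity), smul_eq_mul] at h
  rw [hpow, hhalf, mul_right_comm, ← h]
  field_simp

end LinearChangeOfVariables

theorem norm_le_opNorm_toEuclideanLin_inv_mul {n : Type*} [Fintype n] [DecidableEq n]
    {A : Matrix n n ℝ} (hA : IsUnit A.det) (x : EuclideanSpace ℝ n) :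
    ‖x‖ ≤ ‖LinearMap.toContinuousLinearMap (Matrix.toEuclideanLin A⁻¹)‖ *
      ‖Matrix.toEuclideanLin A x‖ := by
  have h : Matrix.toEuclideanLin A⁻¹ (Matrix.toEuclideanLin A x) = x := by
    rw [← LinearMap.comp_apply, ← Matrix.toLpLin_mul_same, Matrix.nonsing_inv_mul A hA,
      Matrix.toLpLin_one, LinearMap.id_apply]
  simpa [h] using (LinearMap.toContinuousLinearMap (Matrix.toEuclideanLin A⁻¹)).le_opNorm
    (Matrix.toEuclideanLin A x)

/-- Linear-model Gaussian approximation: for an invertible `n × n` matrix `A`, a point `x₀`,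
and a `K`-Lipschitz `u : ℝⁿ → ℝ`,
`|(λ/π)^{n/2} ∫ exp(−λ‖A(x−x₀)‖²) u(x) dx − u(x₀)/|det A|| ≤ (K·‖A⁻¹‖_op·c_n/|det A|)·λ^{−1/2}`,
where `c_n = π^{−n/2} ∫ exp(−‖z‖²)‖z‖ dz`. -/
theorem gaussian_approximation_linear_model (n : ℕ) (hn : 1 ≤ n)
    (A : Matrix (Fin n) (Fin n) ℝ) (hA : IsUnit A.det)
    (x₀ : EuclideanSpace ℝ (Fin n)) (u : EuclideanSpace ℝ (Fin n) → ℝ)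
    (K : ℝ≥0) (hu : LipschitzWith K u) (lam : ℝ) (hlam : 0 < lam) :
    abs ((lam / Real.pi) ^ ((n : ℝ) / 2) *
        (∫ x : EuclideanSpace ℝ (Fin n),
          Real.exp (-lam * ‖Matrix.toEuclideanLin A (x - x₀)‖ ^ 2) * u x)
      - u x₀ / |A.det|)
      ≤ ((K : ℝ) * ‖LinearMap.toContinuousLinearMap (Matrix.toEuclideanLin A⁻¹)‖ *
          (Real.pi ^ (-(n : ℝ) / 2) *
            ∫ z : EuclideanSpace ℝ (Fin n), Real.exp (-‖z‖ ^ 2) * ‖z‖) / |A.det|)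
        * lam ^ (-(1 : ℝ) / 2) := by
  have : Nonempty (Fin n) := ⟨⟨0, hn⟩⟩
  set L := Matrix.toEuclideanLin A
  set M := ‖LinearMap.toContinuousLinearMap (Matrix.toEuclideanLin A⁻¹)‖
  have hdet : LinearMap.det L = A.det := LinearMap.det_toLpLin 2 A
  have hdet0 : LinearMap.det L ≠ 0 := hdet ▸ hA.ne_zero
  have hint (k : ℕ) : Integrable
      (fun x ↦ Real.exp (-lam * ‖L (x - x₀)‖ ^ 2) * ‖L (x - x₀)‖ ^ k) :=
    ((integrable_exp_neg_mul_sq_norm_mul_norm_pow volume hlam k).comp_linearMap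
      volume hdet0).comp_sub_right x₀
  have hgauss : Integrable (fun x ↦ Real.exp (-lam * ‖L (x - x₀)‖ ^ 2)) := by
    simpa using hint 0
  have hmoment : Integrable
      (fun x ↦ Real.exp (-lam * ‖L (x - x₀)‖ ^ 2) * ‖L (x - x₀)‖) := by
    simpa using hint 1
  have hmass : (∫ x, Real.exp (-lam * ‖L (x - x₀)‖ ^ 2)) =
      |A.det|⁻¹ * (Real.pi / lam) ^ ((n : ℝ) / 2) := by
    rw [integral_sub_right_eq_self (fun x ↦ Real.exp (-lam * ‖L x‖ ^ 2)) x₀,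
      integral_comp_linearMap volume hdet0 (fun y ↦ Real.exp (-lam * ‖y‖ ^ 2)),
      GaussianFourier.integral_rexp_neg_mul_sq_norm hlam, hdet, finrank_euclideanSpace_fin,
      smul_eq_mul]
  have hfirst : (∫ x, Real.exp (-lam * ‖L (x - x₀)‖ ^ 2) * ‖L (x - x₀)‖) =
      |A.det|⁻¹ * (lam ^ (-(n : ℝ) / 2) * lam ^ (-(1 : ℝ) / 2) *
        ∫ z : EuclideanSpace ℝ (Fin n), Real.exp (-‖z‖ ^ 2) * ‖z‖) := by
    rw [integral_sub_right_eq_self (fun x ↦ Real.exp (-lam * ‖L x‖ ^ 2) * ‖L x‖) x₀,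
      integral_comp_linearMap volume hdet0 (fun y ↦ Real.exp (-lam * ‖y‖ ^ 2) * ‖y‖),
      integral_exp_neg_mul_sq_norm_mul_norm volume hlam, hdet, finrank_euclideanSpace_fin,
      smul_eq_mul]
  have hbound (x : EuclideanSpace ℝ (Fin n)) :
      ‖Real.exp (-lam * ‖L (x - x₀)‖ ^ 2) * (u x - u x₀)‖ ≤
        K * M * (Real.exp (-lam * ‖L (x - x₀)‖ ^ 2) * ‖L (x - x₀)‖) := by
    rw [norm_mul, Real.norm_of_nonneg (Real.exp_nonneg _)]
    calc Real.exp (-lam * ‖L (x - x₀)‖ ^ 2) * ‖u x - u x₀‖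
        ≤ Real.exp (-lam * ‖L (x - x₀)‖ ^ 2) * (K * (M * ‖L (x - x₀)‖)) := by
          gcongr
          refine (hu.norm_sub_le x x₀).trans ?_
          gcongr
          exact norm_le_opNorm_toEuclideanLin_inv_mul hA _
      _ = _ := by ring
  have hdiff : Integrable (fun x ↦ Real.exp (-lam * ‖L (x - x₀)‖ ^ 2) * (u x - u x₀)) :=
    (hmoment.const_mul (K * M)).mono'
      (hgauss.aestronglyMeasurable.mul
        (hu.continuous.sub continuous_const).aestronglyMeasurable) (.of_forall hbound)
  have hsplit : (∫ x, Real.exp (-lam * ‖L (x - x₀)‖ ^ 2) * u x) =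
      (∫ x, Real.exp (-lam * ‖L (x - x₀)‖ ^ 2) * (u x - u x₀)) +
        |A.det|⁻¹ * (Real.pi / lam) ^ ((n : ℝ) / 2) * u x₀ := by
    rw [← hmass, ← integral_mul_const, ← integral_add hdiff (hgauss.mul_const _)]
    congr 1 with x
    ring
  have herror := norm_integral_le_of_norm_le (hmoment.const_mul (K * M)) (.of_forall hbound)
  rw [integral_const_mul, hfirst, Real.norm_eq_abs] at herror
  have hnorm : (lam / Real.pi) ^ ((n : ℝ) / 2) * (Real.pi / lam) ^ ((n : ℝ) / 2) = 1 := by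
    rw [← Real.mul_rpow (by positivity) (by positivity), div_mul_div_cancel₀ Real.pi_ne_zero,
      div_self hlam.ne', Real.one_rpow]
  have hcancel : (lam / Real.pi) ^ ((n : ℝ) / 2) * lam ^ (-(n : ℝ) / 2) =
      Real.pi ^ (-(n : ℝ) / 2) := by
    rw [Real.div_rpow hlam.le Real.pi_pos.le, neg_div, Real.rpow_neg hlam.le,
      Real.rpow_neg Real.pi_pos.le]
    field_simp
  have hcollapse : (lam / Real.pi) ^ ((n : ℝ) / 2) *
      (∫ x, Real.exp (-lam * ‖L (x - x₀)‖ ^ 2) * u x) - u x₀ / |A.det| =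
      (lam / Real.pi) ^ ((n : ℝ) / 2) *
        ∫ x, Real.exp (-lam * ‖L (x - x₀)‖ ^ 2) * (u x - u x₀) := by
    rw [hsplit]
    linear_combination (u x₀ * |A.det|⁻¹) * hnorm
  rw [hcollapse, abs_mul, abs_of_nonneg (by positivity)]
  refine (mul_le_mul_of_nonneg_left herror (by positivity)).trans_eq ?_
  rw [← hcancel]
  ring
end
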